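/- arXiv:2102.04631 — 2 statements merged into one kernel-verified Lean document; each statement's English description precedes it below -/
import Mathlib

section
/- (Boundary estimates for eigenfunctions, Lemma 3.5 (3.2).) Let R > 0 and let V : ℝ³ → ℝ be a smooth function with V ≥ 0 and support contained in the open ball of radius R centered at 0. Then there exists a constant C > 0, depending only on R and V, such that for every real μ ≥ 1 + 2·sup|V| and every smooth (C^∞) real-valued function u on ℝ³ satisfying Δ(Δu)(x) + V(x)·u(x) = μ·u(x) for all x in the closed ball B_R, u(x) = 0 and Δu(x) = 0 for all x on the sphere S_R = {x : ‖x‖ = R}, and ∫_{B_R} u(x)² dx = 1, one has ∫_{S_R} |∂_ν u(x)|² dσ_R(x) ≤ C·μ and ∫_{S_R} |∂_ν(Δu)(x)|² dσ_R(x) ≤ C·μ². -/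
open MeasureTheory

/-- The Laplacian on `ℝ³`: the trace of the second Fréchet derivative, computed as the sum
of the pure second derivatives along the standard orthonormal basis. -/
noncomputable def lap (f : EuclideanSpace ℝ (Fin 3) → ℝ) (x : EuclideanSpace ℝ (Fin 3)) : ℝ :=
  ∑ i : Fin 3,
    fderiv ℝ (fun y => fderiv ℝ f y (EuclideanSpace.single i (1 : ℝ))) x
      (EuclideanSpace.single i (1 : ℝ))

local notation "E3" => EuclideanSpace ℝ (Fin 3)
local notation "S2" => Metric.sphere (0 : EuclideanSpace ℝ (Fin 3)) 1
local notation "τ" => Measure.toSphere (volume : Measure (EuclideanSpace ℝ (Fin 3)))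

theorem integral_eq_integral_sphere {h : E3 → ℝ} (hh : Integrable h) :
    ∫ x, h x = ∫ r in Set.Ioi (0 : ℝ), r ^ 2 * ∫ ω : S2, h (r • (ω : E3)) ∂τ := by
  have hmp := (volume : Measure E3).measurePreserving_homeomorphUnitSphereProd
  have hemb := Homeomorph.measurableEmbedding (homeomorphUnitSphereProd E3)
  have hcomp : ∀ x : ({(0 : E3)}ᶜ : Set E3),
      ((homeomorphUnitSphereProd E3 x).2 : ℝ) • ((homeomorphUnitSphereProd E3 x).1 : E3) = x := by
    intro x
    exact congrArg Subtype.val ((homeomorphUnitSphereProd E3).symm_apply_apply x)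
  have hdim : Module.finrank ℝ E3 - 1 = 2 := by simp
  have hint : Integrable (fun p : S2 × Set.Ioi (0 : ℝ) => h ((p.2 : ℝ) • (p.1 : E3)))
      (Measure.prod τ (Measure.volumeIoiPow 2)) := by
    rw [← hdim, ← hmp.integrable_comp_emb hemb]
    have : ((fun p : S2 × Set.Ioi (0 : ℝ) => h ((p.2 : ℝ) • (p.1 : E3))) ∘
        homeomorphUnitSphereProd E3) = fun x : ({(0 : E3)}ᶜ : Set E3) => h x := by
      ext x
      exact congrArg h (hcomp x)
    rw [this]
    have := (integrableOn_iff_comap_subtypeVal (f := h) (μ := volume)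
      (measurableSet_singleton (0 : E3)).compl).1 hh.integrableOn
    exact this
  calc ∫ x, h x = ∫ x : ({(0 : E3)}ᶜ : Set E3), h x ∂(volume.comap Subtype.val) := by
        rw [integral_subtype_comap (measurableSet_singleton _).compl h, restrict_compl_singleton]
    _ = ∫ p : S2 × Set.Ioi (0 : ℝ), h ((p.2 : ℝ) • (p.1 : E3))
          ∂(Measure.prod τ (Measure.volumeIoiPow 2)) := by
        rw [← hdim, ← hmp.integral_comp hemb]
        exact integral_congr_ae (.of_forall fun x => (congrArg h (hcomp x)).symm)
    _ = ∫ r : Set.Ioi (0 : ℝ), ∫ ω : S2, h ((r : ℝ) • (ω : E3)) ∂τ ∂(Measure.volumeIoiPow 2) :=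
        integral_prod_symm _ hint
    _ = _ := by
        simp only [Measure.volumeIoiPow, ENNReal.ofReal]
        rw [integral_withDensity_eq_integral_smul,
          integral_subtype_comap measurableSet_Ioi
            fun a ↦ Real.toNNReal (a ^ 2) • ∫ ω : S2, h (a • (ω : E3)) ∂τ]
        · refine setIntegral_congr_fun measurableSet_Ioi fun x hx => ?_
          simp only [NNReal.smul_def, smul_eq_mul]
          rw [Real.coe_toNNReal _ (by positivity)]
        · exact (measurable_subtype_coe.pow_const _).real_toNNReal

theorem setIntegral_closedBall_eq_integral_sphere {f : E3 → ℝ} (hf : Continuous f) {R : ℝ}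
    (hR : 0 ≤ R) :
    ∫ x in Metric.closedBall (0 : E3) R, f x =
      ∫ r in (0 : ℝ)..R, r ^ 2 * ∫ ω : S2, f (r • (ω : E3)) ∂τ := by
  have hint : Integrable ((Metric.closedBall (0 : E3) R).indicator f) :=
    (hf.continuousOn.integrableOn_compact (isCompact_closedBall _ _)).integrable_indicator
      measurableSet_closedBall
  rw [← integral_indicator measurableSet_closedBall, integral_eq_integral_sphere hint,
    intervalIntegral.integral_of_le hR, ← Set.Ioi_inter_Iic,
    ← setIntegral_indicator measurableSet_Iic]
  refine setIntegral_congr_fun measurableSet_Ioi fun r (hr : 0 < r) => ?_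
  by_cases hrR : r ≤ R
  · simp [Set.indicator, norm_smul, abs_of_pos hr, hrR]
  · simp [Set.indicator, norm_smul, abs_of_pos hr, hrR]

theorem continuous_integral_sphere {f : E3 → ℝ} (hf : Continuous f) :
    Continuous fun r : ℝ => ∫ ω : S2, f (r • (ω : E3)) ∂τ := by
  have : CompactSpace S2 := inferInstance
  have h := continuous_parametric_integral_of_continuous (μ := τ)
    (f := fun (r : ℝ) (ω : S2) => f (r • (ω : E3))) (by fun_prop) (s := Set.univ) isCompact_univ
  simpa using h

theorem hasDerivAt_max_zero_sq (s : ℝ) :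
    HasDerivAt (fun t : ℝ => max t 0 ^ 2) (2 * max s 0) s := by
  rcases lt_trichotomy s 0 with hs | rfl | hs
  · rw [max_eq_right hs.le, mul_zero]
    refine (hasDerivAt_const s (0 : ℝ)).congr_of_eventuallyEq ?_
    filter_upwards [Iio_mem_nhds hs] with t (ht : t < 0)
    simp [max_eq_right ht.le]
  · rw [max_self, mul_zero, hasDerivAt_iff_isLittleO_nhds_zero]
    refine Asymptotics.IsBigO.trans_isLittleO (g := fun h : ℝ => h ^ 2) ?_ ?_
    · refine Asymptotics.IsBigO.of_bound 1 (.of_forall fun h => ?_)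
      rcases le_total h 0 with hh | hh
      · simp [max_eq_right hh]; positivity
      · simp [max_eq_left hh]
    · simpa using Asymptotics.isLittleO_pow_id (𝕜 := ℝ) (n := 2) (by norm_num)
  · rw [max_eq_left hs.le]
    refine ((hasDerivAt_pow 2 s).congr_of_eventuallyEq ?_).congr_deriv (by simp)
    filter_upwards [Ioi_mem_nhds hs] with t (ht : 0 < t)
    simp [max_eq_left ht.le]

theorem integral_radial_mul_div {F : Fin 3 → E3 → ℝ} (hF : ∀ i, ContDiff ℝ 1 (F i)) {R : ℝ}
    (hR : 0 ≤ R) :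
    ∫ x in Metric.closedBall (0 : E3) R, (R ^ 2 - ‖x‖ ^ 2) ^ 2 *
        ∑ i, fderiv ℝ (F i) x (EuclideanSpace.single i 1) =
      4 * ∫ x in Metric.closedBall (0 : E3) R, (R ^ 2 - ‖x‖ ^ 2) * ∑ i, x i * F i x := by
  set q : E3 → ℝ := fun x => max (R ^ 2 - ‖x‖ ^ 2) 0 with hq
  have hqc : Continuous q := by fun_prop
  have hq0 : ∀ x, x ∉ Metric.closedBall (0 : E3) R → q x = 0 := by
    intro x hx
    have : R < ‖x‖ := by simpa using hx
    exact max_eq_right (by nlinarith)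
  have hq1 : ∀ x ∈ Metric.closedBall (0 : E3) R, q x = R ^ 2 - ‖x‖ ^ 2 := by
    intro x hx
    have : ‖x‖ ≤ R := by simpa using hx
    exact max_eq_left (by nlinarith [norm_nonneg x])
  have hsupp : HasCompactSupport q :=
    HasCompactSupport.intro (isCompact_closedBall (0 : E3) R) hq0
  have hderiv : ∀ x, HasFDerivAt (fun x => q x ^ 2)
      ((2 * q x) • (-(2 • innerSL ℝ x : E3 →L[ℝ] ℝ))) x := by
    intro x
    have h1 : HasFDerivAt (fun x : E3 => R ^ 2 - ‖x‖ ^ 2) (-(2 • innerSL ℝ x : E3 →L[ℝ] ℝ)) x := by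
      simpa using (hasStrictFDerivAt_norm_sq x).hasFDerivAt.const_sub (R ^ 2)
    exact (hasDerivAt_max_zero_sq _).comp_hasFDerivAt x h1
  have hfd : ∀ x i, fderiv ℝ (fun x => q x ^ 2) x (EuclideanSpace.single i 1) =
      -(4 * q x * x i) := by
    intro x i
    rw [(hderiv x).fderiv]
    simp [EuclideanSpace.inner_single_right]
    ring
  have hFc : ∀ i, Continuous (F i) := fun i => (hF i).continuous
  have hFd : ∀ i, Continuous fun x => fderiv ℝ (F i) x (EuclideanSpace.single i 1) := fun i =>
    ((hF i).continuous_fderiv one_ne_zero).clm_apply continuous_const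
  have hI1 : ∀ i, Integrable fun x =>
      q x ^ 2 * fderiv ℝ (F i) x (EuclideanSpace.single i 1) := fun i =>
    ((hqc.pow 2).mul (hFd i)).integrable_of_hasCompactSupport
      (HasCompactSupport.mul_right (by simpa [pow_two] using hsupp.mul_right))
  have hI2 : ∀ i, Integrable fun x => q x * (x i * F i x) := fun i => by
    have := hFc i
    exact Continuous.integrable_of_hasCompactSupport (by fun_prop) hsupp.mul_right
  have hI3 : ∀ i, Integrable fun x => q x ^ 2 * F i x := fun i =>
    ((hqc.pow 2).mul (hFc i)).integrable_of_hasCompactSupport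
      (HasCompactSupport.mul_right (by simpa [pow_two] using hsupp.mul_right))
  have hkey : ∀ i, ∫ x, q x ^ 2 * fderiv ℝ (F i) x (EuclideanSpace.single i 1) =
      4 * ∫ x, q x * (x i * F i x) := by
    intro i
    rw [integral_mul_fderiv_eq_neg_fderiv_mul_of_integrable (f := fun x => q x ^ 2) _ (hI1 i)
      (hI3 i) (fun x _ => (hderiv x).differentiableAt)
      (fun x _ => (hF i).differentiable one_ne_zero x), ← integral_const_mul, ← integral_neg]
    · refine integral_congr_ae (.of_forall fun x => ?_)
      simp only [hfd]
      ring
    · refine ((hI2 i).const_mul (-4)).congr (.of_forall fun x => ?_)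
      simp only [hfd]
      ring
  have hL : ∫ x in Metric.closedBall (0 : E3) R, (R ^ 2 - ‖x‖ ^ 2) ^ 2 *
        ∑ i, fderiv ℝ (F i) x (EuclideanSpace.single i 1) =
      ∫ x, q x ^ 2 * ∑ i, fderiv ℝ (F i) x (EuclideanSpace.single i 1) := by
    refine (setIntegral_congr_fun measurableSet_closedBall fun x hx => ?_).trans
      (setIntegral_eq_integral_of_forall_compl_eq_zero fun x hx => ?_)
    · simp only [hq1 x hx]
    · simp only [hq0 x hx]
      ring
  have hRt : ∫ x in Metric.closedBall (0 : E3) R, (R ^ 2 - ‖x‖ ^ 2) * ∑ i, x i * F i x =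
      ∫ x, q x * ∑ i, x i * F i x := by
    refine (setIntegral_congr_fun measurableSet_closedBall fun x hx => ?_).trans
      (setIntegral_eq_integral_of_forall_compl_eq_zero fun x hx => ?_)
    · simp only [hq1 x hx]
    · simp only [hq0 x hx]
      ring
  rw [hL, hRt]
  simp only [Finset.mul_sum]
  rw [integral_finsetSum _ fun i _ => hI1 i, integral_finsetSum _ fun i _ => hI2 i,
    Finset.mul_sum]
  exact Finset.sum_congr rfl fun i _ => hkey i

/-- The divergence theorem on a closed ball of `ℝ³`. -/
theorem integral_closedBall_div {F : Fin 3 → E3 → ℝ} (hF : ∀ i, ContDiff ℝ 1 (F i)) {R : ℝ}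
    (hR : 0 < R) :
    ∫ x in Metric.closedBall (0 : E3) R, ∑ i, fderiv ℝ (F i) x (EuclideanSpace.single i 1) =
      R ^ 2 * ∫ ω : S2, ∑ i, (ω : E3) i * F i (R • (ω : E3)) ∂τ := by
  have hFc : ∀ i, Continuous (F i) := fun i => (hF i).continuous
  have hFd : ∀ i, Continuous fun x => fderiv ℝ (F i) x (EuclideanSpace.single i 1) := fun i =>
    ((hF i).continuous_fderiv one_ne_zero).clm_apply continuous_const
  set D : E3 → ℝ := fun x => ∑ i, fderiv ℝ (F i) x (EuclideanSpace.single i 1) with hD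
  set N : E3 → ℝ := fun x => ∑ i, x i * F i x with hN
  have hDc : Continuous D := by fun_prop
  have hNc : Continuous N := by fun_prop
  set d : ℝ → ℝ := fun r => r ^ 2 * ∫ ω : S2, D (r • (ω : E3)) ∂τ with hd
  set n : ℝ → ℝ := fun r => r ^ 2 * ∫ ω : S2, N (r • (ω : E3)) ∂τ with hn
  have hdc : Continuous d := (continuous_pow 2).mul (continuous_integral_sphere hDc)
  have hnc : Continuous n := (continuous_pow 2).mul (continuous_integral_sphere hNc)
  have hnorm : ∀ (r : ℝ) (ω : S2), ‖r • (ω : E3)‖ ^ 2 = r ^ 2 := by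
    intro r ω
    simp [norm_smul]
  have hprim : ∀ {g : ℝ → ℝ}, Continuous g → ∀ s : ℝ,
      HasDerivAt (fun s => ∫ r in (0 : ℝ)..s, g r) (g s) s := fun hg s =>
    intervalIntegral.integral_hasDerivAt_right (hg.intervalIntegrable _ _)
      (hg.stronglyMeasurableAtFilter _ _) hg.continuousAt
  have hid0 : ∀ s : ℝ, 0 ≤ s → ∫ r in (0 : ℝ)..s, (s ^ 2 - r ^ 2) ^ 2 * d r =
      4 * ∫ r in (0 : ℝ)..s, (s ^ 2 - r ^ 2) * n r := by
    intro s hs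
    have h := integral_radial_mul_div hF hs
    rw [setIntegral_closedBall_eq_integral_sphere (f := fun x => (s ^ 2 - ‖x‖ ^ 2) ^ 2 * D x)
        (by fun_prop) hs,
      setIntegral_closedBall_eq_integral_sphere (f := fun x => (s ^ 2 - ‖x‖ ^ 2) * N x)
        (by fun_prop) hs] at h
    simp only [hnorm, integral_const_mul] at h
    have hd' : ∀ r, (s ^ 2 - r ^ 2) ^ 2 * d r =
        r ^ 2 * ((s ^ 2 - r ^ 2) ^ 2 * ∫ ω : S2, D (r • (ω : E3)) ∂τ) :=
      fun r => mul_left_comm _ _ _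
    have hn' : ∀ r, (s ^ 2 - r ^ 2) * n r =
        r ^ 2 * ((s ^ 2 - r ^ 2) * ∫ ω : S2, N (r • (ω : E3)) ∂τ) :=
      fun r => mul_left_comm _ _ _
    simp only [hd', hn']
    exact h
  have hexp1 : ∀ {g : ℝ → ℝ}, Continuous g → ∀ s : ℝ, ∫ r in (0 : ℝ)..s, (s ^ 2 - r ^ 2) * g r =
      s ^ 2 * (∫ r in (0 : ℝ)..s, g r) - ∫ r in (0 : ℝ)..s, r ^ 2 * g r := by
    intro g hg s
    rw [← intervalIntegral.integral_const_mul, ← intervalIntegral.integral_sub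
      ((by fun_prop : Continuous fun r => s ^ 2 * g r).intervalIntegrable _ _)
      ((by fun_prop : Continuous fun r => r ^ 2 * g r).intervalIntegrable _ _)]
    simp only [sub_mul]
  have hexp2 : ∀ s : ℝ, ∫ r in (0 : ℝ)..s, (s ^ 2 - r ^ 2) ^ 2 * d r =
      s ^ 2 * (∫ r in (0 : ℝ)..s, (s ^ 2 - r ^ 2) * d r) -
        (s ^ 2 * (∫ r in (0 : ℝ)..s, r ^ 2 * d r) - ∫ r in (0 : ℝ)..s, r ^ 2 * (r ^ 2 * d r)) := by
    intro s
    rw [← hexp1 (by fun_prop), ← intervalIntegral.integral_const_mul,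
      ← intervalIntegral.integral_sub
      ((by fun_prop : Continuous fun r => s ^ 2 * ((s ^ 2 - r ^ 2) * d r)).intervalIntegrable _ _)
      ((by fun_prop : Continuous fun r => (s ^ 2 - r ^ 2) * (r ^ 2 * d r)).intervalIntegrable _ _)]
    congr 1
    ext r
    ring
  have hderiv1 : ∀ {g : ℝ → ℝ}, Continuous g → ∀ s : ℝ,
      HasDerivAt (fun s => ∫ r in (0 : ℝ)..s, (s ^ 2 - r ^ 2) * g r)
        (2 * s * ∫ r in (0 : ℝ)..s, g r) s := by
    intro g hg s
    simp only [hexp1 hg]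
    refine (((hasDerivAt_pow 2 s).mul (hprim hg s)).sub
      (hprim (g := fun r => r ^ 2 * g r) (by fun_prop) s)).congr_deriv ?_
    simp
  have hderiv2 : ∀ s : ℝ, HasDerivAt (fun s => ∫ r in (0 : ℝ)..s, (s ^ 2 - r ^ 2) ^ 2 * d r)
      (4 * s * ∫ r in (0 : ℝ)..s, (s ^ 2 - r ^ 2) * d r) s := by
    intro s
    simp only [hexp2]
    refine (((hasDerivAt_pow 2 s).mul (hderiv1 hdc s)).sub
      (((hasDerivAt_pow 2 s).mul (hprim (g := fun r => r ^ 2 * d r) (by fun_prop) s)).sub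
      (hprim (g := fun r => r ^ 2 * (r ^ 2 * d r)) (by fun_prop) s))).congr_deriv ?_
    rw [hexp1 hdc]
    push_cast
    ring
  have hid1 : ∀ s : ℝ, 0 < s → ∫ r in (0 : ℝ)..s, (s ^ 2 - r ^ 2) * d r =
      2 * ∫ r in (0 : ℝ)..s, n r := by
    intro s hs
    have h := (hderiv2 s).unique (((hderiv1 hnc s).const_mul 4).congr_of_eventuallyEq
      (by filter_upwards [Ioi_mem_nhds hs] with t (ht : 0 < t) using hid0 t ht.le))
    refine mul_left_cancel₀ (mul_pos four_pos hs).ne' (h.trans ?_)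
    ring
  have hid2 : ∫ r in (0 : ℝ)..R, d r = R⁻¹ * n R := by
    have h := (hderiv1 hdc R).unique (((hprim hnc R).const_mul 2).congr_of_eventuallyEq
      (by filter_upwards [Ioi_mem_nhds hR] with t (ht : 0 < t) using hid1 t ht))
    rw [eq_inv_mul_iff_mul_eq₀ hR.ne']
    linarith
  rw [setIntegral_closedBall_eq_integral_sphere hDc hR.le]
  change ∫ r in (0 : ℝ)..R, d r = _
  have hNR : ∀ ω : S2, N (R • (ω : E3)) = R * ∑ i, (ω : E3) i * F i (R • (ω : E3)) := by
    intro ω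
    simp [hN, Finset.mul_sum, mul_assoc]
  rw [hid2]
  simp only [hn, hNR, integral_const_mul]
  field_simp

/-- Two finite measures on a sphere that are invariant under linear isometries are proportional;
this is the inequality half of that statement, tested against nonnegative continuous functions. -/
theorem measure_mul_lintegral_le_of_isometry_invariant {E : Type*} [NormedAddCommGroup E]
    [InnerProductSpace ℝ E] [FiniteDimensional ℝ E] [MeasurableSpace E] [BorelSpace E]
    {σ ν : Measure E} [IsFiniteMeasure σ] [IsFiniteMeasure ν] {R : ℝ}
    (hσ : ∀ e : E ≃ₗᵢ[ℝ] E, σ.map e = σ) (hν : ∀ e : E ≃ₗᵢ[ℝ] E, ν.map e = ν)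
    (hσS : ∀ᵐ x ∂σ, x ∈ Metric.sphere (0 : E) R) (hνS : ∀ᵐ x ∂ν, x ∈ Metric.sphere (0 : E) R)
    {g : E → ℝ} (hg : Continuous g) {ε : ℝ} (hε : 0 < ε) :
    ν Set.univ * ∫⁻ x, ENNReal.ofReal (g x) ∂σ ≤
      σ Set.univ * ∫⁻ x, ENNReal.ofReal (g x + ε) ∂ν := by
  rcases eq_or_ne (ν Set.univ) 0 with h0 | h0
  · simp [h0]
  have hS : IsCompact (Metric.sphere (0 : E) R) := isCompact_sphere _ _
  have hνSne : ν (Metric.sphere (0 : E) R) ≠ 0 := by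
    rwa [measure_congr (ae_eq_univ.2 hνS : (Metric.sphere (0 : E) R : Set E) =ᵐ[ν] Set.univ)]
  obtain ⟨y₀, hy₀⟩ : (Metric.sphere (0 : E) R).Nonempty := nonempty_of_measure_ne_zero hνSne
  obtain ⟨r, hr, hgr⟩ := Metric.uniformContinuousOn_iff.1
    (hS.uniformContinuousOn_of_continuous hg.continuousOn) ε hε
  have hball : ∀ {m : Measure E}, (∀ e : E ≃ₗᵢ[ℝ] E, m.map e = m) →
      ∀ y ∈ Metric.sphere (0 : E) R, m (Metric.ball y r) = m (Metric.ball y₀ r) := by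
    intro m hm y hy
    have hn : ‖y‖ = ‖y₀‖ := by
      rw [mem_sphere_zero_iff_norm.1 hy, mem_sphere_zero_iff_norm.1 hy₀]
    set e := (ℝ ∙ (y - y₀))ᗮ.reflection with he
    have hey : e y = y₀ := Submodule.reflection_sub hn
    conv_rhs => rw [← hm e, Measure.map_apply e.continuous.measurable measurableSet_ball, ← hey]
    exact congrArg m (e.isometry.preimage_ball y r).symm
  set a := σ (Metric.ball y₀ r)
  set b := ν (Metric.ball y₀ r)
  have hb : b ≠ 0 := fun hb0 => hνSne <| hS.measure_zero_of_nhdsWithin fun y hy =>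
    ⟨Metric.ball y r, mem_nhdsWithin_of_mem_nhds (Metric.ball_mem_nhds y hr),
      (hball hν y hy).trans hb0⟩
  set k : E → E → ENNReal := fun x y => (Metric.ball y r).indicator 1 x with hk
  have hksymm : ∀ x y, k x y = k y x := fun x y => by
    simp [hk, Set.indicator, dist_comm]
  have hkm : Measurable (Function.uncurry k) := by
    have : Function.uncurry k = Set.indicator {p : E × E | dist p.1 p.2 < r} 1 := by
      ext ⟨x, y⟩
      simp [hk, Function.uncurry, Set.indicator]
    rw [this]
    exact measurable_one.indicator
      (isOpen_lt (continuous_fst.dist continuous_snd) continuous_const).measurableSet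
  have hkσ : ∀ y ∈ Metric.sphere (0 : E) R, ∫⁻ x, k x y ∂σ = a := fun y hy => by
    exact (lintegral_indicator_one measurableSet_ball).trans (hball hσ y hy)
  have hkν : ∀ x ∈ Metric.sphere (0 : E) R, ∫⁻ y, k x y ∂ν = b := fun x hx => by
    simp_rw [hksymm x]
    exact (lintegral_indicator_one measurableSet_ball).trans (hball hν x hx)
  have hfub : ∀ {f : E → ENNReal}, Measurable f →
      b * ∫⁻ x, f x ∂σ = ∫⁻ y, ∫⁻ x, f x * k x y ∂σ ∂ν := by
    intro f hf
    rw [← lintegral_lintegral_swap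
      ((hf.comp measurable_fst).mul hkm).aemeasurable, ← lintegral_const_mul _ hf]
    refine lintegral_congr_ae ?_
    filter_upwards [hσS] with x hx
    have hkx : Measurable (k x) := hkm.comp (measurable_const.prodMk measurable_id)
    rw [lintegral_const_mul _ hkx, hkν x hx, mul_comm]
  have hky : ∀ y, Measurable fun x => k x y := fun y =>
    hkm.comp (measurable_id.prodMk measurable_const)
  have hone : b * σ Set.univ = a * ν Set.univ := by
    have h := hfub (f := fun _ => 1) measurable_const
    simp only [one_mul, lintegral_const] at h
    rw [h, ← lintegral_const]
    refine lintegral_congr_ae ?_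
    filter_upwards [hνS] with y hy using hkσ y hy
  have hGle : b * ∫⁻ x, ENNReal.ofReal (g x) ∂σ ≤ a * ∫⁻ x, ENNReal.ofReal (g x + ε) ∂ν := by
    have hgm : Measurable fun x => ENNReal.ofReal (g x) := hg.measurable.ennreal_ofReal
    have hgm' : Measurable fun x => ENNReal.ofReal (g x + ε) :=
      (hg.measurable.add_const ε).ennreal_ofReal
    rw [hfub hgm, ← lintegral_const_mul _ hgm']
    refine lintegral_mono_ae ?_
    filter_upwards [hνS] with y hy
    rw [← hkσ y hy, mul_comm, ← lintegral_const_mul _ (hky y)]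
    refine lintegral_mono_ae ?_
    filter_upwards [hσS] with x hx
    by_cases hxy : dist x y < r
    · gcongr
      have := hgr x hx y hy hxy
      rw [Real.dist_eq, abs_lt] at this
      linarith
    · simp [hk, hxy]
  refine (ENNReal.mul_le_mul_iff_right hb (measure_ne_top ν _)).1 ?_
  calc b * (ν Set.univ * ∫⁻ x, ENNReal.ofReal (g x) ∂σ)
      = ν Set.univ * (b * ∫⁻ x, ENNReal.ofReal (g x) ∂σ) := by ring
    _ ≤ ν Set.univ * (a * ∫⁻ x, ENNReal.ofReal (g x + ε) ∂ν) := by gcongr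
    _ = (a * ν Set.univ) * ∫⁻ x, ENNReal.ofReal (g x + ε) ∂ν := by ring
    _ = _ := by rw [← hone]; ring

theorem measureReal_mul_integral_le_of_isometry_invariant {E : Type*} [NormedAddCommGroup E]
    [InnerProductSpace ℝ E] [FiniteDimensional ℝ E] [MeasurableSpace E] [BorelSpace E]
    {σ ν : Measure E} [IsFiniteMeasure σ] [IsFiniteMeasure ν] {R : ℝ}
    (hσ : ∀ e : E ≃ₗᵢ[ℝ] E, σ.map e = σ) (hν : ∀ e : E ≃ₗᵢ[ℝ] E, ν.map e = ν)
    (hσS : ∀ᵐ x ∂σ, x ∈ Metric.sphere (0 : E) R) (hνS : ∀ᵐ x ∂ν, x ∈ Metric.sphere (0 : E) R)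
    {g : E → ℝ} (hg : Continuous g) (hg0 : ∀ x, 0 ≤ g x) :
    ν.real Set.univ * ∫ x, g x ∂σ ≤ σ.real Set.univ * ∫ x, g x ∂ν := by
  have hint : ∀ {m : Measure E} [IsFiniteMeasure m],
      (∀ᵐ x ∂m, x ∈ Metric.sphere (0 : E) R) → Integrable g m := by
    intro m _ hm
    have := hg.continuousOn.integrableOn_compact (μ := m) (isCompact_sphere (0 : E) R)
    rwa [IntegrableOn, Measure.restrict_eq_self_of_ae_mem hm] at this
  have hσg := hint hσS
  have hνg := hint hνS
  have key : ∀ ε : ℝ, 0 < ε → ν.real Set.univ * ∫ x, g x ∂σ ≤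
      σ.real Set.univ * (∫ x, g x ∂ν) + ε * (σ.real Set.univ * ν.real Set.univ) := by
    intro ε hε
    have h := measure_mul_lintegral_le_of_isometry_invariant hσ hν hσS hνS hg hε
    have hεint : Integrable (fun x => g x + ε) ν := hνg.add (integrable_const ε)
    rw [← ofReal_integral_eq_lintegral_ofReal hσg (.of_forall hg0),
      ← ofReal_integral_eq_lintegral_ofReal hεint (.of_forall fun x => by
        have := hg0 x
        positivity)] at h
    have h' := ENNReal.toReal_mono (by finiteness) h
    rw [ENNReal.toReal_mul, ENNReal.toReal_mul, ENNReal.toReal_ofReal (integral_nonneg hg0),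
      ENNReal.toReal_ofReal (integral_nonneg fun x => by have := hg0 x; positivity),
      integral_add hνg (integrable_const ε)] at h'
    simp only [integral_const, smul_eq_mul] at h'
    calc _ ≤ _ := h'
      _ = _ := by simp only [Measure.real]; ring
  by_contra! hlt
  set c := σ.real Set.univ * ν.real Set.univ with hc
  have hc0 : 0 ≤ c := by positivity
  set δ := ν.real Set.univ * (∫ x, g x ∂σ) - σ.real Set.univ * ∫ x, g x ∂ν with hδ
  have hδ0 : 0 < δ := sub_pos.2 hlt
  have h := key (δ / (2 * (c + 1))) (by positivity)
  have : δ / (2 * (c + 1)) * c ≤ δ / 2 := by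
    rw [div_mul_eq_mul_div, div_le_div_iff₀ (by positivity) two_pos]
    nlinarith
  linarith

/-- Spherical coordinates show that a sphere in `ℝ³` has finite two-dimensional Hausdorff
measure. -/
theorem hausdorffMeasure_sphere_lt_top (R : ℝ) :
    μH[(2 : ℝ)] (Metric.sphere (0 : E3) R) < ⊤ := by
  set f : ℝ × ℝ → E3 := fun p => WithLp.toLp 2
    ![R * (Real.sin p.1 * Real.cos p.2), R * (Real.sin p.1 * Real.sin p.2), R * Real.cos p.1]
    with hf
  set Q : Set (ℝ × ℝ) := Metric.closedBall 0 4 with hQ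
  have hfc : ContDiff ℝ 1 f := by
    rw [contDiff_euclidean]
    intro i
    fin_cases i <;> simp [hf] <;> fun_prop
  obtain ⟨K, hK⟩ := hfc.contDiffOn.exists_lipschitzOnWith (s := Q) one_ne_zero (convex_closedBall _ _)
    (isCompact_closedBall _ _)
  have hQtop : μH[(2 : ℝ)] Q < ⊤ := by
    rw [hausdorffMeasure_prod_real]
    exact (isCompact_closedBall _ _).measure_lt_top
  have himg : μH[(2 : ℝ)] (f '' Q) < ⊤ :=
    (hK.hausdorffMeasure_image_le two_pos.le).trans_lt
      (ENNReal.mul_lt_top (by finiteness) hQtop)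
  refine (measure_mono ?_).trans_lt himg
  intro x hx
  have hxR : x 0 ^ 2 + x 1 ^ 2 + x 2 ^ 2 = R ^ 2 := by
    rw [← mem_sphere_zero_iff_norm.1 hx, EuclideanSpace.norm_sq_eq, Fin.sum_univ_three]
    simp
  have hR0 : 0 ≤ R := by
    rw [← mem_sphere_zero_iff_norm.1 hx]
    exact norm_nonneg x
  rcases hR0.eq_or_lt with h0 | hR
  · refine ⟨0, by simp [hQ], ?_⟩
    have : x = 0 := by rw [← norm_eq_zero, mem_sphere_zero_iff_norm.1 hx, h0]
    rw [this]
    ext i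
    fin_cases i <;> simp [hf, ← h0]
  set w : ℂ := ⟨x 0, x 1⟩ with hw
  have hz : -1 ≤ x 2 / R ∧ x 2 / R ≤ 1 := by
    rw [div_le_one hR, le_div_iff₀ hR]
    constructor <;> nlinarith [sq_nonneg (x 0), sq_nonneg (x 1)]
  have hsin : R * Real.sin (Real.arccos (x 2 / R)) = ‖w‖ := by
    rw [Real.sin_arccos, Complex.norm_eq_sqrt_sq_add_sq]
    rw [← Real.sqrt_sq hR.le, ← Real.sqrt_mul (sq_nonneg R), Real.sqrt_sq hR.le]
    congr 1
    simp only [hw]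
    field_simp
    linarith
  refine ⟨(Real.arccos (x 2 / R), w.arg), ?_, ?_⟩
  · have h1 := Real.arccos_nonneg (x 2 / R)
    have h2 := Real.arccos_le_pi (x 2 / R)
    have h3 := Complex.abs_arg_le_pi w
    have h4 := Real.pi_le_four
    rw [hQ, mem_closedBall_zero_iff, Prod.norm_def, max_le_iff]
    constructor
    · rw [Real.norm_eq_abs, abs_of_nonneg h1]
      exact h2.trans h4
    · exact h3.trans h4
  · ext i
    fin_cases i
    · simp [hf, ← mul_assoc, hsin, Complex.norm_mul_cos_arg, hw]
    · simp [hf, ← mul_assoc, hsin, Complex.norm_mul_sin_arg, hw]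
    · simp [hf, Real.cos_arccos hz.1 hz.2]
      field_simp

theorem map_hausdorffMeasure_restrict_sphere (R : ℝ) (e : E3 ≃ₗᵢ[ℝ] E3) :
    (μH[(2 : ℝ)].restrict (Metric.sphere (0 : E3) R)).map e =
      μH[(2 : ℝ)].restrict (Metric.sphere (0 : E3) R) := by
  have h := (e.toIsometryEquiv.measurePreserving_hausdorffMeasure 2).restrict_preimage
    (s := Metric.sphere (0 : E3) R) Metric.isClosed_sphere.measurableSet
  have hpre : e.toIsometryEquiv ⁻¹' Metric.sphere (0 : E3) R = Metric.sphere (0 : E3) R := by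
    ext x
    simp
  rw [hpre] at h
  exact h.map_eq

open scoped Pointwise in
theorem map_map_toSphere (R : ℝ) (e : E3 ≃ₗᵢ[ℝ] E3) :
    (Measure.map (fun ω : S2 => R • (ω : E3)) τ).map e =
      Measure.map (fun ω : S2 => R • (ω : E3)) τ := by
  have hm : Measurable fun ω : S2 => R • (ω : E3) := by fun_prop
  have he : Measurable e := e.continuous.measurable
  ext s hs
  rw [Measure.map_apply he hs, Measure.map_apply hm (he hs), Measure.map_apply hm hs,
    Measure.toSphere_apply' _ (hm (he hs)), Measure.toSphere_apply' _ (hm hs)]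
  congr 1
  have hset : Set.Ioo (0 : ℝ) 1 • (Subtype.val '' ((fun ω : S2 => R • (ω : E3)) ⁻¹' (e ⁻¹' s))) =
      e ⁻¹' (Set.Ioo (0 : ℝ) 1 • (Subtype.val '' ((fun ω : S2 => R • (ω : E3)) ⁻¹' s))) := by
    ext x
    constructor
    · rintro ⟨r, hr, _, ⟨ω, hω, rfl⟩, rfl⟩
      refine ⟨r, hr, e ω, ⟨⟨e ω, by simp⟩, ?_, rfl⟩, by simp⟩
      simpa using hω
    · rintro ⟨r, hr, _, ⟨ω, hω, rfl⟩, hx⟩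
      refine ⟨r, hr, e.symm ω, ⟨⟨e.symm ω, by simp⟩, ?_, rfl⟩, ?_⟩
      · simpa using hω
      · apply e.injective
        simpa using hx
  rw [hset]
  exact e.measurePreserving.measure_preimage_emb e.toHomeomorph.measurableEmbedding _

theorem exists_integral_sphere_hausdorffMeasure_le {R : ℝ} (hR : 0 < R) :
    ∃ K, 0 ≤ K ∧ ∀ g : E3 → ℝ, Continuous g → (∀ x, 0 ≤ g x) →
      ∫ x in Metric.sphere (0 : E3) R, g x ∂μH[(2 : ℝ)] ≤
        K * ∫ ω : S2, g (R • (ω : E3)) ∂τ := by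
  set σ : Measure E3 := μH[(2 : ℝ)].restrict (Metric.sphere (0 : E3) R) with hσ
  set ν : Measure E3 := Measure.map (fun ω : S2 => R • (ω : E3)) τ with hν
  have hm : Measurable fun ω : S2 => R • (ω : E3) := by fun_prop
  have : IsFiniteMeasure σ := ⟨by
    rw [hσ, Measure.restrict_apply_univ]
    exact hausdorffMeasure_sphere_lt_top R⟩
  have hνS : ∀ᵐ x ∂ν, x ∈ Metric.sphere (0 : E3) R := by
    refine (ae_map_iff hm.aemeasurable
      (Metric.isClosed_sphere (x := (0 : E3)) (ε := R)).measurableSet).2 (.of_forall fun ω => ?_)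
    simp [norm_smul, hR.le]
  have hν0 : 0 < ν.real Set.univ := by
    rw [Measure.real, hν, Measure.map_apply hm .univ, Set.preimage_univ]
    refine ENNReal.toReal_pos ?_ (measure_ne_top _ _)
    rw [Ne, Measure.measure_univ_eq_zero]
    exact Measure.toSphere_ne_zero _
  refine ⟨σ.real Set.univ / ν.real Set.univ, by positivity, fun g hg hg0 => ?_⟩
  have h := measureReal_mul_integral_le_of_isometry_invariant
    (map_hausdorffMeasure_restrict_sphere R) (map_map_toSphere R)
    (ae_restrict_mem Metric.isClosed_sphere.measurableSet) hνS hg hg0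
  rw [← hν, ← hσ, hν, integral_map hm.aemeasurable hg.aestronglyMeasurable, ← hν] at h
  rw [div_mul_eq_mul_div, le_div_iff₀ hν0, mul_comm]
  exact h

/-- The `i`-th partial derivative of a function on `ℝ³`. -/
noncomputable def pderiv (i : Fin 3) (f : E3 → ℝ) (x : E3) : ℝ :=
  fderiv ℝ f x (EuclideanSpace.single i 1)

theorem lap_eq_sum_pderiv (f : E3 → ℝ) (x : E3) : lap f x = ∑ i, pderiv i (pderiv i f) x := rfl

theorem pderiv_add {f g : E3 → ℝ} (hf : Differentiable ℝ f) (hg : Differentiable ℝ g) (i : Fin 3)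
    (x : E3) : pderiv i (fun y => f y + g y) x = pderiv i f x + pderiv i g x := by
  simp only [pderiv]
  rw [fderiv_fun_add (hf x) (hg x)]
  simp

theorem pderiv_const_mul {f : E3 → ℝ} (hf : Differentiable ℝ f) (c : ℝ) (i : Fin 3) (x : E3) :
    pderiv i (fun y => c * f y) x = c * pderiv i f x := by
  simp only [pderiv]
  rw [fderiv_const_mul (hf x)]
  simp

theorem pderiv_mul {f g : E3 → ℝ} (hf : Differentiable ℝ f) (hg : Differentiable ℝ g) (i : Fin 3)
    (x : E3) :
    pderiv i (fun y => f y * g y) x = f x * pderiv i g x + g x * pderiv i f x := by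
  simp only [pderiv]
  rw [fderiv_fun_mul (hf x) (hg x)]
  simp

theorem pderiv_sum {f : Fin 3 → E3 → ℝ} (hf : ∀ j, Differentiable ℝ (f j)) (i : Fin 3) (x : E3) :
    pderiv i (fun y => ∑ j, f j y) x = ∑ j, pderiv i (f j) x := by
  simp only [pderiv]
  rw [fderiv_fun_sum fun j _ => hf j x]
  simp

theorem pderiv_coord (i j : Fin 3) (x : E3) :
    pderiv i (fun y : E3 => y j) x = if i = j then 1 else 0 := by
  have h : (fun y : E3 => y j) = (EuclideanSpace.proj j : E3 →L[ℝ] ℝ) := rfl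
  simp only [pderiv]
  rw [h, ContinuousLinearMap.fderiv]
  simp [eq_comm]

theorem ContDiff.pderiv {f : E3 → ℝ} (hf : ContDiff ℝ (⊤ : ℕ∞) f) (i : Fin 3) :
    ContDiff ℝ (⊤ : ℕ∞) (pderiv i f) :=
  (hf.fderiv_right (m := (⊤ : ℕ∞)) (by simp)).clm_apply contDiff_const

theorem ContDiff.lap {f : E3 → ℝ} (hf : ContDiff ℝ (⊤ : ℕ∞) f) :
    ContDiff ℝ (⊤ : ℕ∞) (lap f) :=
  ContDiff.sum fun i _ => (hf.pderiv i).pderiv i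

theorem pderiv_comm {f : E3 → ℝ} (hf : ContDiff ℝ (⊤ : ℕ∞) f) (i j : Fin 3) (x : E3) :
    pderiv i (pderiv j f) x = pderiv j (pderiv i f) x := by
  have hd : DifferentiableAt ℝ (fderiv ℝ f) x :=
    (hf.fderiv_right (m := (⊤ : ℕ∞)) (by simp)).differentiable (by simp) x
  have h : ∀ a b : Fin 3, pderiv a (pderiv b f) x =
      fderiv ℝ (fderiv ℝ f) x (EuclideanSpace.single a 1) (EuclideanSpace.single b 1) := by
    intro a b
    change fderiv ℝ (fun y => fderiv ℝ f y (EuclideanSpace.single b 1)) x _ = _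
    rw [fderiv_clm_apply hd (differentiableAt_const _)]
    simp
  rw [h, h]
  have h2 : minSmoothness ℝ 2 ≤ ((⊤ : ℕ∞) : WithTop ℕ∞) := by
    rw [minSmoothness_of_isRCLikeNormedField]
    exact (WithTop.coe_le_coe.2 le_top : ((2 : ℕ∞) : WithTop ℕ∞) ≤ ((⊤ : ℕ∞) : WithTop ℕ∞))
  exact (hf.contDiffAt.isSymmSndFDerivAt h2).eq _ _

/-- Green's first identity on a ball for a function vanishing on the boundary sphere. -/
theorem integral_pderiv_mul_pderiv_add_mul_lap {f g : E3 → ℝ} (hf : ContDiff ℝ (⊤ : ℕ∞) f)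
    (hg : ContDiff ℝ (⊤ : ℕ∞) g) {R : ℝ} (hR : 0 < R)
    (hf0 : ∀ x ∈ Metric.sphere (0 : E3) R, f x = 0) :
    ∫ x in Metric.closedBall (0 : E3) R, ((∑ i, pderiv i f x * pderiv i g x) + f x * lap g x) =
      0 := by
  have h := integral_closedBall_div (F := fun i x => f x * pderiv i g x)
    (fun i => (hf.mul (hg.pderiv i)).of_le (by simp)) hR
  have h0 : ∀ ω : S2, f (R • (ω : E3)) = 0 := fun ω => hf0 _ (by simp [norm_smul, hR.le])
  simp only [h0, zero_mul, mul_zero, Finset.sum_const_zero, integral_zero] at h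
  rw [← h]
  refine setIntegral_congr_fun measurableSet_closedBall fun x _ => ?_
  change _ = ∑ i, pderiv i (fun y => f y * pderiv i g y) x
  simp only [pderiv_mul (hf.differentiable (by simp)) ((hg.pderiv _).differentiable (by simp)),
    lap_eq_sum_pderiv, Finset.sum_add_distrib, Finset.mul_sum]
  rw [add_comm]
  simp only [mul_comm]

theorem fderiv_apply_eq_zero_of_inner_eq_zero {f : E3 → ℝ} (hf : Differentiable ℝ f) {R : ℝ}
    (hR : 0 < R) (hf0 : ∀ x ∈ Metric.sphere (0 : E3) R, f x = 0) {x : E3}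
    (hx : x ∈ Metric.sphere (0 : E3) R) {v : E3} (hv : inner ℝ x v = 0) :
    fderiv ℝ f x v = 0 := by
  rcases eq_or_ne v 0 with rfl | hv0
  · simp
  have hvn : 0 < ‖v‖ := norm_pos_iff.2 hv0
  have hxn : ‖x‖ = R := mem_sphere_zero_iff_norm.1 hx
  set v' : E3 := (R / ‖v‖) • v with hv'
  have hv'n : ‖v'‖ = R := by
    rw [hv', norm_smul, Real.norm_of_nonneg (by positivity), div_mul_cancel₀ _ hvn.ne']
  have hv'x : inner ℝ x v' = 0 := by rw [hv', inner_smul_right, hv, mul_zero]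
  set c : ℝ → E3 := fun t => Real.cos t • x + Real.sin t • v' with hc
  have hcS : ∀ t, f (c t) = 0 := by
    intro t
    refine hf0 _ ?_
    rw [mem_sphere_zero_iff_norm, ← sq_eq_sq₀ (norm_nonneg _) hR.le, hc, norm_add_sq_real]
    simp only [norm_smul, inner_smul_left, inner_smul_right, hv'x, hxn, hv'n, mul_pow,
      Real.norm_eq_abs, sq_abs]
    simp only [mul_zero, add_zero, ← add_mul, Real.cos_sq_add_sin_sq, one_mul]
  have hcd : HasDerivAt c v' 0 := by
    have h := ((Real.hasDerivAt_cos 0).smul_const x).add ((Real.hasDerivAt_sin 0).smul_const v')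
    exact (show HasDerivAt c _ 0 from h).congr_deriv (by simp)
  have hc0 : c 0 = x := by simp [hc]
  have hcomp : HasDerivAt (f ∘ c) (fderiv ℝ f x v') 0 := by
    refine HasFDerivAt.comp_hasDerivAt (0 : ℝ) ?_ hcd
    rw [hc0]
    exact (hf x).hasFDerivAt
  have hzero : f ∘ c = fun _ => 0 := funext hcS
  rw [hzero] at hcomp
  have h := hcomp.unique (hasDerivAt_const 0 0)
  rw [hv', map_smul, smul_eq_mul] at h
  exact (mul_eq_zero.1 h).resolve_left (by positivity)

theorem pderiv_eq_of_eq_zero_on_sphere {f : E3 → ℝ} (hf : Differentiable ℝ f) {R : ℝ}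
    (hR : 0 < R) (hf0 : ∀ x ∈ Metric.sphere (0 : E3) R, f x = 0) (ω : S2) (i : Fin 3) :
    pderiv i f (R • (ω : E3)) = (ω : E3) i * fderiv ℝ f (R • (ω : E3)) ω := by
  have hω : inner ℝ (ω : E3) ω = 1 := by
    rw [real_inner_self_eq_norm_sq]
    simp
  have h := fderiv_apply_eq_zero_of_inner_eq_zero hf hR hf0 (x := R • (ω : E3))
    (by simp [norm_smul, hR.le]) (v := EuclideanSpace.single i 1 - (ω : E3) i • (ω : E3)) (by
      rw [inner_smul_left, inner_sub_right, inner_smul_right, hω]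
      simp [EuclideanSpace.inner_single_right])
  rw [map_sub, map_smul, smul_eq_mul, sub_eq_zero] at h
  exact h

/-- The Rellich identity on a ball for a function vanishing on the boundary sphere. -/
theorem integral_rellich {f : E3 → ℝ} (hf : ContDiff ℝ (⊤ : ℕ∞) f) {R : ℝ} (hR : 0 < R)
    (hf0 : ∀ x ∈ Metric.sphere (0 : E3) R, f x = 0) :
    ∫ x in Metric.closedBall (0 : E3) R,
        ((∑ j, x j * pderiv j f x) * lap f x - (∑ j, pderiv j f x ^ 2) / 2) =
      R ^ 3 / 2 * ∫ ω : S2, fderiv ℝ f (R • (ω : E3)) ω ^ 2 ∂τ := by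
  have hfd : Differentiable ℝ f := hf.differentiable (by simp)
  have hp : ∀ j, ContDiff ℝ (⊤ : ℕ∞) (pderiv j f) := fun j => hf.pderiv j
  have hpd : ∀ j, Differentiable ℝ (pderiv j f) := fun j => (hp j).differentiable (by simp)
  have hx : ∀ j, ContDiff ℝ (⊤ : ℕ∞) fun x : E3 => x j := fun j => by fun_prop
  have hxd : ∀ j, Differentiable ℝ fun x : E3 => x j := fun j => by fun_prop
  set A : E3 → ℝ := fun x => ∑ j, x j * pderiv j f x with hA
  set G : E3 → ℝ := fun x => ∑ j, pderiv j f x * pderiv j f x with hG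
  have hAc : ContDiff ℝ (⊤ : ℕ∞) A := ContDiff.sum fun j _ => (hx j).mul (hp j)
  have hGc : ContDiff ℝ (⊤ : ℕ∞) G := ContDiff.sum fun j _ => (hp j).mul (hp j)
  have hAd : Differentiable ℝ A := hAc.differentiable (by simp)
  have hGd : Differentiable ℝ G := hGc.differentiable (by simp)
  have hA' : ∀ i x, pderiv i A x = pderiv i f x + ∑ j, x j * pderiv i (pderiv j f) x := by
    intro i x
    rw [hA, pderiv_sum (f := fun j x => x j * pderiv j f x) fun j => (hxd j).mul (hpd j)]
    simp [pderiv_mul (hxd _) (hpd _), pderiv_coord, Finset.sum_add_distrib, add_comm]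
  have hG' : ∀ i x, pderiv i G x = ∑ j, 2 * (pderiv j f x * pderiv i (pderiv j f) x) := by
    intro i x
    rw [hG, pderiv_sum (f := fun j x => pderiv j f x * pderiv j f x) fun j => (hpd j).mul (hpd j)]
    simp only [pderiv_mul (hpd _) (hpd _), two_mul]
  have h := integral_closedBall_div (F := fun i x => A x * pderiv i f x + x i * (-1 / 2 * G x))
    (fun i => ((hAc.mul (hp i)).add ((hx i).mul (contDiff_const.mul hGc))).of_le (by simp)) hR
  have hdiv : ∀ i x, pderiv i (fun x => A x * pderiv i f x + x i * (-1 / 2 * G x)) x =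
      A x * pderiv i (pderiv i f) x + pderiv i f x * pderiv i A x +
        (x i * (-1 / 2 * pderiv i G x) + (-1 / 2 * G x)) := by
    intro i x
    rw [pderiv_add (f := fun x => A x * pderiv i f x) (g := fun x => x i * (-1 / 2 * G x))
      (hAd.mul (hpd i)) ((hxd i).mul (hGd.const_mul _)), pderiv_mul hAd (hpd i),
      pderiv_mul (hxd i) (hGd.const_mul _), pderiv_const_mul hGd, pderiv_coord]
    simp
  have hL : ∀ x, ∑ i, fderiv ℝ (fun x => A x * pderiv i f x + x i * (-1 / 2 * G x)) x
      (EuclideanSpace.single i 1) =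
      A x * lap f x - (∑ j, pderiv j f x ^ 2) / 2 := by
    intro x
    change ∑ i, pderiv i (fun x => A x * pderiv i f x + x i * (-1 / 2 * G x)) x = _
    rw [Finset.sum_congr rfl fun i _ => hdiv i x]
    simp only [hA', hG']
    simp only [hG, lap_eq_sum_pderiv, Fin.sum_univ_three,
      pderiv_comm hf 1 0, pderiv_comm hf 2 0, pderiv_comm hf 2 1]
    ring
  have hB : ∀ ω : S2, ∑ i, (ω : E3) i * (A (R • (ω : E3)) * pderiv i f (R • (ω : E3)) +
      (R • (ω : E3)) i * (-1 / 2 * G (R • (ω : E3)))) =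
      R / 2 * fderiv ℝ f (R • (ω : E3)) ω ^ 2 := by
    intro ω
    have hω : (ω : E3) 0 ^ 2 + (ω : E3) 1 ^ 2 + (ω : E3) 2 ^ 2 = 1 := by
      have h1 : ‖(ω : E3)‖ ^ 2 = 1 := by simp
      rw [EuclideanSpace.norm_sq_eq, Fin.sum_univ_three] at h1
      simpa using h1
    simp only [hA, hG, pderiv_eq_of_eq_zero_on_sphere hfd hR hf0 ω, Fin.sum_univ_three,
      PiLp.smul_apply, smul_eq_mul]
    set L := fderiv ℝ f (R • (ω : E3)) ω
    set s := (ω : E3) 0 ^ 2 + (ω : E3) 1 ^ 2 + (ω : E3) 2 ^ 2 with hs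
    calc _ = R / 2 * L ^ 2 * s ^ 2 := by rw [hs]; ring
      _ = _ := by rw [hω]; ring
  simp only [hL, hB, integral_const_mul] at h
  rw [h]
  ring

theorem integral_normal_sq_le {f : E3 → ℝ} (hf : ContDiff ℝ (⊤ : ℕ∞) f) {R : ℝ} (hR : 0 < R)
    (hf0 : ∀ x ∈ Metric.sphere (0 : E3) R, f x = 0) :
    R ^ 2 * ∫ ω : S2, fderiv ℝ f (R • (ω : E3)) ω ^ 2 ∂τ ≤
      ∫ x in Metric.closedBall (0 : E3) R, ((∑ j, pderiv j f x * pderiv j f x) + lap f x ^ 2) := by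
  have hp : ∀ j, Continuous (pderiv j f) := fun j => (hf.pderiv j).continuous
  have hl : Continuous (lap f) := hf.lap.continuous
  have hint : ∀ {g : E3 → ℝ}, Continuous g → IntegrableOn g (Metric.closedBall (0 : E3) R) :=
    fun hg => hg.continuousOn.integrableOn_compact (isCompact_closedBall _ _)
  have h : R ^ 3 / 2 * ∫ ω : S2, fderiv ℝ f (R • (ω : E3)) ω ^ 2 ∂τ ≤
      ∫ x in Metric.closedBall (0 : E3) R,
        R / 2 * ((∑ j, pderiv j f x * pderiv j f x) + lap f x ^ 2) := by
    rw [← integral_rellich hf hR hf0]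
    refine setIntegral_mono_on (hint (by fun_prop)) (hint (by fun_prop))
      measurableSet_closedBall fun x hx => ?_
    have hxR : x 0 ^ 2 + x 1 ^ 2 + x 2 ^ 2 ≤ R ^ 2 := by
      have h1 : ‖x‖ ^ 2 ≤ R ^ 2 :=
        pow_le_pow_left₀ (norm_nonneg _) (mem_closedBall_zero_iff.1 hx) 2
      rw [EuclideanSpace.norm_sq_eq, Fin.sum_univ_three] at h1
      simpa using h1
    simp only [Fin.sum_univ_three]
    generalize pderiv 0 f x = a
    generalize pderiv 1 f x = b
    generalize pderiv 2 f x = c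
    generalize lap f x = l
    have hcs : (x 0 * a + x 1 * b + x 2 * c) ^ 2 ≤ R ^ 2 * (a ^ 2 + b ^ 2 + c ^ 2) := by
      calc (x 0 * a + x 1 * b + x 2 * c) ^ 2
          ≤ (x 0 ^ 2 + x 1 ^ 2 + x 2 ^ 2) * (a ^ 2 + b ^ 2 + c ^ 2) := by
            nlinarith [sq_nonneg (x 0 * b - x 1 * a), sq_nonneg (x 0 * c - x 2 * a),
              sq_nonneg (x 1 * c - x 2 * b)]
        _ ≤ _ := by gcongr
    generalize x 0 * a + x 1 * b + x 2 * c = t at hcs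
    have hsq : 2 * R * (t * l) ≤ R * (R * (a ^ 2 + b ^ 2 + c ^ 2 + l ^ 2)) := by
      nlinarith [sq_nonneg (t - R * l)]
    have h2 : 2 * (t * l) ≤ R * (a ^ 2 + b ^ 2 + c ^ 2 + l ^ 2) :=
      le_of_mul_le_mul_left (by linarith) hR
    nlinarith [sq_nonneg a, sq_nonneg b, sq_nonneg c]
  rw [integral_const_mul] at h
  refine le_of_mul_le_mul_left (a := R / 2) ?_ (by positivity)
  linarith

/-- Boundary flux of a function vanishing on a sphere, given a comparison of the Hausdorff measure
of the sphere with the spherical measure coming from polar coordinates. -/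
theorem setIntegral_sphere_normal_sq_le {R K : ℝ} (hR : 0 < R) (hK : 0 ≤ K)
    (hcomp : ∀ g : E3 → ℝ, Continuous g → (∀ x, 0 ≤ g x) →
      ∫ x in Metric.sphere (0 : E3) R, g x ∂μH[2] ≤ K * ∫ ω : S2, g (R • (ω : E3)) ∂τ)
    {f : E3 → ℝ} (hf : ContDiff ℝ (⊤ : ℕ∞) f) (hf0 : ∀ x ∈ Metric.sphere (0 : E3) R, f x = 0) :
    ∫ x in Metric.sphere (0 : E3) R, (fderiv ℝ f x (R⁻¹ • x)) ^ 2 ∂μH[2] ≤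
      K / R ^ 2 * ∫ x in Metric.closedBall (0 : E3) R,
        ((∑ j, pderiv j f x * pderiv j f x) + lap f x ^ 2) := by
  have hc : Continuous fun x : E3 => (fderiv ℝ f x (R⁻¹ • x)) ^ 2 :=
    ((hf.continuous_fderiv (by simp)).clm_apply (continuous_const_smul _)).pow 2
  refine (hcomp _ hc fun x => sq_nonneg _).trans ?_
  simp only [smul_smul, inv_mul_cancel₀ hR.ne', one_smul]
  rw [div_mul_eq_mul_div, le_div_iff₀ (by positivity), mul_assoc]
  refine mul_le_mul_of_nonneg_left ?_ hK
  rw [mul_comm]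
  exact integral_normal_sq_le hf hR hf0

theorem le_iSup_abs_of_tsupport_subset_ball {V : E3 → ℝ} (hV : Continuous V) {R : ℝ}
    (hVsupp : tsupport V ⊆ Metric.ball (0 : E3) R) (x : E3) : |V x| ≤ ⨆ y, |V y| := by
  have hcs : HasCompactSupport V :=
    (isCompact_closedBall (0 : E3) R).of_isClosed_subset (isClosed_tsupport V)
      (hVsupp.trans Metric.ball_subset_closedBall)
  obtain ⟨C, hC⟩ := hV.bounded_above_of_compact_support hcs
  exact le_ciSup (f := fun y => |V y|) ⟨C, by rintro _ ⟨y, rfl⟩; exact hC y⟩ x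

/-- Energy estimates for a function and its Laplacian, both vanishing on the boundary of a ball,
in terms of an equation `Δ²u = q u` with a bounded nonnegative coefficient. -/
theorem energy_le {u q : E3 → ℝ} (hu : ContDiff ℝ (⊤ : ℕ∞) u) {R μ : ℝ} (hR : 0 < R) (hμ : 1 ≤ μ)
    (hq : ∀ x, 0 ≤ q x ∧ q x ≤ μ)
    (heq : ∀ x ∈ Metric.closedBall (0 : E3) R, lap (lap u) x = q x * u x)
    (hu0 : ∀ x ∈ Metric.sphere (0 : E3) R, u x = 0)
    (hw0 : ∀ x ∈ Metric.sphere (0 : E3) R, lap u x = 0)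
    (hu1 : ∫ x in Metric.closedBall (0 : E3) R, u x ^ 2 = 1) :
    (∫ x in Metric.closedBall (0 : E3) R,
        ((∑ j, pderiv j u x * pderiv j u x) + lap u x ^ 2) ≤ 2 * μ) ∧
    (∫ x in Metric.closedBall (0 : E3) R,
        ((∑ j, pderiv j (lap u) x * pderiv j (lap u) x) + lap (lap u) x ^ 2) ≤ 2 * μ ^ 2) := by
  have hw : ContDiff ℝ (⊤ : ℕ∞) (lap u) := hu.lap
  have hucont : Continuous u := hu.continuous
  have hwcont : Continuous (lap u) := hw.continuous
  have hlwcont : Continuous (lap (lap u)) := hw.lap.continuous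
  have hpu : ∀ j, Continuous (pderiv j u) := fun j => (hu.pderiv j).continuous
  have hpw : ∀ j, Continuous (pderiv j (lap u)) := fun j => (hw.pderiv j).continuous
  have hint : ∀ {g : E3 → ℝ}, Continuous g → IntegrableOn g (Metric.closedBall (0 : E3) R) :=
    fun hg => hg.continuousOn.integrableOn_compact (isCompact_closedBall _ _)
  have hle : ∀ {g h : E3 → ℝ}, Continuous g → Continuous h →
      (∀ x ∈ Metric.closedBall (0 : E3) R, g x ≤ h x) →
      ∫ x in Metric.closedBall (0 : E3) R, g x ≤ ∫ x in Metric.closedBall (0 : E3) R, h x :=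
    fun hg hh h => setIntegral_mono_on (hint hg) (hint hh) measurableSet_closedBall h
  have hsplit : ∀ {g h : E3 → ℝ}, Continuous g → Continuous h →
      ∫ x in Metric.closedBall (0 : E3) R, (g x + h x) =
        (∫ x in Metric.closedBall (0 : E3) R, g x) + ∫ x in Metric.closedBall (0 : E3) R, h x :=
    fun hg hh => integral_add (hint hg) (hint hh)
  have huw := integral_pderiv_mul_pderiv_add_mul_lap hu hw hR hu0
  have hwu := integral_pderiv_mul_pderiv_add_mul_lap hw hu hR hw0
  have huu := integral_pderiv_mul_pderiv_add_mul_lap hu hu hR hu0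
  have hww := integral_pderiv_mul_pderiv_add_mul_lap hw hw hR hw0
  rw [hsplit (by fun_prop) (by fun_prop)] at huw hwu huu hww
  simp only [mul_comm (pderiv _ (lap u) _) (pderiv _ u _)] at hwu
  have hulw : ∫ x in Metric.closedBall (0 : E3) R, u x * lap (lap u) x ≤ μ := by
    have h := hle (g := fun x => u x * lap (lap u) x) (h := fun x => μ * u x ^ 2)
      (by fun_prop) (by fun_prop) fun x hx => by
        rw [heq x hx]
        nlinarith [hq x, sq_nonneg (u x)]
    rwa [integral_const_mul, hu1, mul_one] at h
  have hw2 : ∫ x in Metric.closedBall (0 : E3) R, lap u x ^ 2 ≤ μ := by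
    simp only [sq]
    linarith
  have hu_lap : -(∫ x in Metric.closedBall (0 : E3) R, u x * lap u x) ≤ μ := by
    have h := hle (g := fun x => -(u x * lap u x))
      (h := fun x => 1 / 2 * u x ^ 2 + 1 / 2 * lap u x ^ 2) (by fun_prop) (by fun_prop)
      fun x _ => by nlinarith [sq_nonneg (u x + lap u x)]
    rw [integral_neg, hsplit (by fun_prop) (by fun_prop), integral_const_mul, integral_const_mul,
      hu1] at h
    linarith
  have hlw2 : ∫ x in Metric.closedBall (0 : E3) R, lap (lap u) x ^ 2 ≤ μ ^ 2 := by
    have h := hle (g := fun x => lap (lap u) x ^ 2) (h := fun x => μ ^ 2 * u x ^ 2)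
      (by fun_prop) (by fun_prop) fun x hx => by
        rw [heq x hx, mul_pow]
        gcongr
        exacts [(hq x).1, (hq x).2]
    rwa [integral_const_mul, hu1, mul_one] at h
  have hw_lap : -(∫ x in Metric.closedBall (0 : E3) R, lap u x * lap (lap u) x) ≤ μ ^ 2 := by
    have h := hle (g := fun x => -(lap u x * lap (lap u) x))
      (h := fun x => 1 / 2 * lap (lap u) x ^ 2 + 1 / 2 * lap u x ^ 2) (by fun_prop) (by fun_prop)
      fun x _ => by nlinarith [sq_nonneg (lap (lap u) x + lap u x)]
    rw [integral_neg, hsplit (by fun_prop) (by fun_prop), integral_const_mul,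
      integral_const_mul] at h
    nlinarith
  constructor
  · rw [hsplit (by fun_prop) (by fun_prop)]
    linarith
  · rw [hsplit (by fun_prop) (by fun_prop)]
    linarith

/-- Boundary estimates for Navier eigenfunctions of `Δ² + V` (Lemma 3.5, (3.2)):
`‖∂_ν u‖²_{L²(S_R)} ≲ μ` and `‖∂_ν(Δu)‖²_{L²(S_R)} ≲ μ²`. -/
theorem eigenfunction_boundary_estimates (R : ℝ) (hR : 0 < R)
    (V : EuclideanSpace ℝ (Fin 3) → ℝ) (hV : ContDiff ℝ (⊤ : ℕ∞) V) (hVnonneg : ∀ x, 0 ≤ V x)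
    (hVsupp : tsupport V ⊆ Metric.ball (0 : EuclideanSpace ℝ (Fin 3)) R) :
    ∃ C > 0, ∀ μ : ℝ, 1 + 2 * (⨆ x, |V x|) ≤ μ →
      ∀ u : EuclideanSpace ℝ (Fin 3) → ℝ, ContDiff ℝ (⊤ : ℕ∞) u →
        (∀ x ∈ Metric.closedBall (0 : EuclideanSpace ℝ (Fin 3)) R,
          lap (lap u) x + V x * u x = μ * u x) →
        (∀ x ∈ Metric.sphere (0 : EuclideanSpace ℝ (Fin 3)) R, u x = 0) →
        (∀ x ∈ Metric.sphere (0 : EuclideanSpace ℝ (Fin 3)) R, lap u x = 0) →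
        (∫ x in Metric.closedBall (0 : EuclideanSpace ℝ (Fin 3)) R, u x ^ 2 = 1) →
        (∫ x in Metric.sphere (0 : EuclideanSpace ℝ (Fin 3)) R,
            (fderiv ℝ u x (R⁻¹ • x)) ^ 2 ∂μH[(2 : ℝ)] ≤ C * μ) ∧
        (∫ x in Metric.sphere (0 : EuclideanSpace ℝ (Fin 3)) R,
            (fderiv ℝ (lap u) x (R⁻¹ • x)) ^ 2 ∂μH[(2 : ℝ)] ≤ C * μ ^ 2) := by
  obtain ⟨K, hK, hcomp⟩ := exists_integral_sphere_hausdorffMeasure_le hR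
  refine ⟨2 * K / R ^ 2 + 1, by positivity, fun μ hμ u hu heq hu0 hw0 hu1 => ?_⟩
  have hVle := le_iSup_abs_of_tsupport_subset_ball hV.continuous hVsupp
  have hV0 : 0 ≤ ⨆ x, |V x| := (abs_nonneg _).trans (hVle 0)
  have hμ1 : 1 ≤ μ := by linarith
  obtain ⟨h1, h2⟩ := energy_le (q := fun x => μ - V x) hu hR hμ1
    (fun x => ⟨by linarith [hVle x, le_abs_self (V x)], by linarith [hVnonneg x]⟩)
    (fun x hx => by linarith [heq x hx]) hu0 hw0 hu1
  have hKR : 0 ≤ K / R ^ 2 := by positivity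
  constructor
  · refine (setIntegral_sphere_normal_sq_le hR hK hcomp hu hu0).trans ?_
    refine (mul_le_mul_of_nonneg_left h1 hKR).trans ?_
    rw [mul_div_assoc]
    nlinarith
  · refine (setIntegral_sphere_normal_sq_le hR hK hcomp hu.lap hw0).trans ?_
    refine (mul_le_mul_of_nonneg_left h2 hKR).trans ?_
    rw [mul_div_assoc]
    nlinarith
end

section
/- (L² bound on Δu for Navier eigenfunctions, step in the proof of Lemma 3.5.) Let R > 0, let V : ℝ³ → ℝ be a bounded measurable function, let μ ∈ ℝ, and let u : ℝ³ → ℝ be a smooth (C^∞) function satisfying Δ(Δu)(x) + V(x)·u(x) = μ·u(x) for all x in the closed ball B_R of radius R centered at 0, u(x) = 0 and Δu(x) = 0 for all x on the sphere S_R = {x : ‖x‖ = R}, and ∫_{B_R} u(x)² dx = 1. Then ∫_{B_R} |Δu(x)|² dx ≤ μ + sup|V|. -/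
open MeasureTheory

/-- A `C¹` function vanishing on a sphere, extended by zero outside the ball, is Lipschitz. -/
lemma exists_lipschitzWith_indicator_closedBall {E : Type*} [NormedAddCommGroup E]
    [NormedSpace ℝ E] [FiniteDimensional ℝ E] {g : E → ℝ} {c : E} {R : ℝ} (hg : ContDiff ℝ 1 g)
    (h0 : ∀ x ∈ Metric.sphere c R, g x = 0) :
    ∃ C, LipschitzWith C ((Metric.closedBall c R).indicator g) := by
  obtain ⟨C, hC⟩ := hg.contDiffOn.exists_lipschitzOnWith one_ne_zero
    (convex_closedBall c R) (isCompact_closedBall c R)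
  have cross : ∀ x ∈ Metric.closedBall c R, ∀ y ∉ Metric.closedBall c R,
      |g x| ≤ C * dist x y := by
    intro x hx y hy
    obtain ⟨z, hz, hzs : z ∈ Metric.sphere c R⟩ :=
      (convex_segment (𝕜 := ℝ) x y).isPreconnected.intermediate_value
        (left_mem_segment ℝ x y) (right_mem_segment ℝ x y)
        (f := fun w => dist w c) (by fun_prop)
        ⟨Metric.mem_closedBall.1 hx, (not_le.1 fun h => hy (Metric.mem_closedBall.2 h)).le⟩
    calc |g x| = dist (g x) (g z) := by simp [h0 z hzs]
      _ ≤ C * dist x z := hC.dist_le_mul x hx z (Metric.sphere_subset_closedBall hzs)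
      _ ≤ C * dist x y := by
        have := dist_add_dist_of_mem_segment hz
        have := dist_nonneg (x := z) (y := y)
        gcongr
        linarith
  refine ⟨C, LipschitzWith.of_dist_le_mul fun x y => ?_⟩
  by_cases hx : x ∈ Metric.closedBall c R <;> by_cases hy : y ∈ Metric.closedBall c R
  · simpa [Set.indicator_of_mem, hx, hy] using hC.dist_le_mul x hx y hy
  · simpa only [Set.indicator_of_mem hx, Set.indicator_of_notMem hy, dist_zero_right,
      Real.norm_eq_abs] using cross x hx y hy
  · simpa only [Set.indicator_of_mem hy, Set.indicator_of_notMem hx, dist_zero_left,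
      Real.norm_eq_abs, dist_comm x y] using cross y hy x hx
  · simp only [Set.indicator_of_notMem hx, Set.indicator_of_notMem hy, dist_self]
    positivity

/-- The integral over a ball of a directional derivative of a `C¹` function vanishing on the
bounding sphere is zero. -/
lemma setIntegral_closedBall_fderiv_eq_zero {E : Type*} [NormedAddCommGroup E]
    [NormedSpace ℝ E] [FiniteDimensional ℝ E] [MeasurableSpace E] [BorelSpace E]
    (ν : Measure E) [ν.IsAddHaarMeasure] {g : E → ℝ} {c : E} {R : ℝ} (hR : R ≠ 0)
    (hg : ContDiff ℝ 1 g) (h0 : ∀ x ∈ Metric.sphere c R, g x = 0) (v : E) :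
    ∫ x in Metric.closedBall c R, fderiv ℝ g x v ∂ν = 0 := by
  obtain ⟨C, hC⟩ := exists_lipschitzWith_indicator_closedBall hg h0
  have hsupp : HasCompactSupport ((Metric.closedBall c R).indicator g) :=
    HasCompactSupport.intro (isCompact_closedBall c R) fun x hx => Set.indicator_of_notMem hx g
  have hparts := (LipschitzWith.const (α := E) (1 : ℝ)).integral_lineDeriv_mul_eq (μ := ν)
    hC hsupp (-v)
  have hzero : ∫ x, lineDeriv ℝ ((Metric.closedBall c R).indicator g) x v ∂ν = 0 := by
    simpa [lineDeriv] using hparts.symm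
  rw [← integral_indicator Metric.isClosed_closedBall.measurableSet, ← hzero]
  refine integral_congr_ae ?_
  have hsphere : ∀ᵐ x ∂ν, x ∉ Metric.sphere c R :=
    measure_eq_zero_iff_ae_notMem.1 (Measure.addHaar_sphere_of_ne_zero ν c hR)
  filter_upwards [hsphere] with x hx
  by_cases hxB : x ∈ Metric.closedBall c R
  · have hxb : x ∈ Metric.ball c R :=
      Metric.mem_ball.2 (lt_of_le_of_ne (Metric.mem_closedBall.1 hxB) hx)
    have heq : (Metric.closedBall c R).indicator g =ᶠ[nhds x] g := by
      filter_upwards [Metric.isOpen_ball.mem_nhds hxb] with y hy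
      exact Set.indicator_of_mem (Metric.ball_subset_closedBall hy) g
    rw [Set.indicator_of_mem hxB, heq.lineDeriv_eq,
      ((hg.differentiable one_ne_zero) x).lineDeriv_eq_fderiv]
  · have heq : (Metric.closedBall c R).indicator g =ᶠ[nhds x] fun _ => (0 : ℝ) := by
      filter_upwards [Metric.isClosed_closedBall.isOpen_compl.mem_nhds hxB] with y hy
      exact Set.indicator_of_notMem hy g
    rw [Set.indicator_of_notMem hxB, heq.lineDeriv_eq]
    simp [lineDeriv]

lemma ContDiff.fderiv_apply_const {E : Type*} [NormedAddCommGroup E] [NormedSpace ℝ E]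
    {f : E → ℝ} (hf : ContDiff ℝ (⊤ : ℕ∞) f) (v : E) :
    ContDiff ℝ (⊤ : ℕ∞) fun x => fderiv ℝ f x v :=
  (hf.fderiv_right (m := (⊤ : ℕ∞)) (by simp)).clm_apply contDiff_const

lemma contDiff_lap {f : EuclideanSpace ℝ (Fin 3) → ℝ} (hf : ContDiff ℝ (⊤ : ℕ∞) f) :
    ContDiff ℝ (⊤ : ℕ∞) (lap f) :=
  ContDiff.sum fun i _ => (hf.fderiv_apply_const (EuclideanSpace.single i 1)).fderiv_apply_const _

/-- Green's second identity on a ball for smooth functions vanishing on the bounding sphere. -/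
lemma setIntegral_closedBall_mul_lap_comm {f g : EuclideanSpace ℝ (Fin 3) → ℝ}
    {c : EuclideanSpace ℝ (Fin 3)} {R : ℝ} (hR : R ≠ 0)
    (hf : ContDiff ℝ (⊤ : ℕ∞) f) (hg : ContDiff ℝ (⊤ : ℕ∞) g)
    (hf0 : ∀ x ∈ Metric.sphere c R, f x = 0) (hg0 : ∀ x ∈ Metric.sphere c R, g x = 0) :
    ∫ x in Metric.closedBall c R, f x * lap g x = ∫ x in Metric.closedBall c R, g x * lap f x := by
  have hint : ∀ {h : EuclideanSpace ℝ (Fin 3) → ℝ}, Continuous h →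
      IntegrableOn h (Metric.closedBall c R) := fun hh =>
    hh.continuousOn.integrableOn_compact (isCompact_closedBall c R)
  let e : Fin 3 → EuclideanSpace ℝ (Fin 3) := fun i => EuclideanSpace.single i 1
  let F : Fin 3 → EuclideanSpace ℝ (Fin 3) → ℝ := fun i x =>
    f x * fderiv ℝ g x (e i) - g x * fderiv ℝ f x (e i)
  have hF : ∀ i, ContDiff ℝ (⊤ : ℕ∞) (F i) := fun i =>
    (hf.mul (hg.fderiv_apply_const (e i))).sub (hg.mul (hf.fderiv_apply_const (e i)))
  have htop : ((⊤ : ℕ∞) : WithTop ℕ∞) ≠ 0 := by simp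
  have hdiv : ∀ x, ∑ i, fderiv ℝ (F i) x (e i) = f x * lap g x - g x * lap f x := by
    intro x
    have hfx := hf.differentiable htop x
    have hgx := hg.differentiable htop x
    have hpart : ∀ i, fderiv ℝ (F i) x (e i) =
        f x * fderiv ℝ (fun y => fderiv ℝ g y (e i)) x (e i) -
          g x * fderiv ℝ (fun y => fderiv ℝ f y (e i)) x (e i) := by
      intro i
      have hfi := (hf.fderiv_apply_const (e i)).differentiable htop x
      have hgi := (hg.fderiv_apply_const (e i)).differentiable htop x
      have := ((hfx.hasFDerivAt.mul hgi.hasFDerivAt).sub (hgx.hasFDerivAt.mul hfi.hasFDerivAt))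
      rw [show fderiv ℝ (F i) x = _ from this.fderiv]
      simp
      ring
    simp only [hpart, Finset.sum_sub_distrib, ← Finset.mul_sum]
    rfl
  have hfg : Continuous fun x => f x * lap g x := hf.continuous.mul (contDiff_lap hg).continuous
  have hgf : Continuous fun x => g x * lap f x := hg.continuous.mul (contDiff_lap hf).continuous
  rw [← sub_eq_zero, ← integral_sub (hint hfg) (hint hgf)]
  simp only [← hdiv]
  rw [integral_finsetSum _ fun i _ => hint ((hF i).fderiv_apply_const (e i)).continuous]
  refine Finset.sum_eq_zero fun i _ =>
    setIntegral_closedBall_fderiv_eq_zero volume hR ((hF i).of_le (by exact_mod_cast le_top)) ?_ _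
  intro x hx
  simp [F, hf0 x hx, hg0 x hx]

/-- `L²` bound on `Δu` for normalized Navier eigenfunctions (step in the proof of
Lemma 3.5): `∫_{B_R} |Δu|² ≤ μ + sup|V|`. -/
theorem laplacian_L2_bound (R : ℝ) (hR : 0 < R)
    (V : EuclideanSpace ℝ (Fin 3) → ℝ) (hVmeas : Measurable V)
    (hVbdd : ∃ B : ℝ, ∀ x, |V x| ≤ B) (μ : ℝ)
    (u : EuclideanSpace ℝ (Fin 3) → ℝ) (hu : ContDiff ℝ (⊤ : ℕ∞) u)
    (hueq : ∀ x ∈ Metric.closedBall (0 : EuclideanSpace ℝ (Fin 3)) R,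
      lap (lap u) x + V x * u x = μ * u x)
    (hu0 : ∀ x ∈ Metric.sphere (0 : EuclideanSpace ℝ (Fin 3)) R, u x = 0)
    (hΔu0 : ∀ x ∈ Metric.sphere (0 : EuclideanSpace ℝ (Fin 3)) R, lap u x = 0)
    (hnorm : ∫ x in Metric.closedBall (0 : EuclideanSpace ℝ (Fin 3)) R, u x ^ 2 = 1) :
    ∫ x in Metric.closedBall (0 : EuclideanSpace ℝ (Fin 3)) R, (lap u x) ^ 2 ≤
      μ + ⨆ x, |V x| := by
  have hlap := contDiff_lap hu
  have hint : ∀ {h : EuclideanSpace ℝ (Fin 3) → ℝ}, Continuous h →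
      IntegrableOn h (Metric.closedBall (0 : EuclideanSpace ℝ (Fin 3)) R) := fun hh =>
    hh.continuousOn.integrableOn_compact (isCompact_closedBall 0 R)
  obtain ⟨B, hB⟩ := hVbdd
  have hbdd : BddAbove (Set.range fun x => |V x|) := ⟨B, by rintro _ ⟨x, rfl⟩; exact hB x⟩
  calc ∫ x in Metric.closedBall (0 : EuclideanSpace ℝ (Fin 3)) R, (lap u x) ^ 2
      = ∫ x in Metric.closedBall (0 : EuclideanSpace ℝ (Fin 3)) R, u x * lap (lap u) x := by
        simp only [pow_two]
        exact setIntegral_closedBall_mul_lap_comm hR.ne' hlap hu hΔu0 hu0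
    _ ≤ ∫ x in Metric.closedBall (0 : EuclideanSpace ℝ (Fin 3)) R,
          (μ + ⨆ x, |V x|) * u x ^ 2 := by
        refine setIntegral_mono_on (hint (hu.continuous.mul (contDiff_lap hlap).continuous))
          (hint (continuous_const.mul (hu.continuous.pow 2)))
          Metric.isClosed_closedBall.measurableSet fun x hx => ?_
        have hV : -V x ≤ ⨆ x, |V x| := (neg_le_abs _).trans (le_ciSup hbdd x)
        have heq : lap (lap u) x = (μ - V x) * u x := by linarith [hueq x hx]
        rw [heq]
        nlinarith [mul_le_mul_of_nonneg_right hV (sq_nonneg (u x))]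
    _ = μ + ⨆ x, |V x| := by rw [integral_const_mul, hnorm, mul_one]
end
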